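/- Let k ≥ 2, 1 ≤ a ≤ k−1, m ≥ 1, and let V^λ be an irreducible highest weight U_q(sl_k)-module with highest weight λ = mω_a and highest weight vector v_λ. For 0 ≤ j ≤ m, set v_j := f_{k−1}^{(j)} f_{k−2}^{(j)} ⋯ f_a^{(j)} v_λ. Then for all 0 ≤ j ≤ m: (1) v_j ≠ 0; (2) e_i v_j = 0 for all 1 ≤ i ≤ k−2; (3) f_i v_j = 0 for all i ∈ {1, …, k−2} with i ∉ {a−1, a}; (4) f_{a−1}^{j+1} v_j = 0 (when a ≥ 2) and f_a^{m−j+1} v_j = 0. -/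

import Mathlib

/-!
Common setup: the quantum group `U_q(sl_k)` (presented by generators
`e_i, f_i, K_i = q^{h_i}, K_i⁻¹` for `1 ≤ i ≤ k-1` and the standard relations)
over the field `KK = ℚ(q)`, and the notion of an irreducible highest weight
module.  Weights are recorded as functions `μ : ℕ → ℤ`, `μ i` being the value
`μ(h_i)` on the `i`-th simple coroot.
-/

noncomputable section
namespace QSL

abbrev KK : Type := RatFunc ℚ

/-- the variable `q`. -/
def qv : KK := RatFunc.X

/-- the quantum integer `[n]_q = (qⁿ - q⁻ⁿ)/(q - q⁻¹)`. -/
def qInt (n : ℕ) : KK := (qv ^ n - qv⁻¹ ^ n) / (qv - qv⁻¹)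

/-- the quantum factorial `[n]_q!`. -/
def qFact : ℕ → KK
  | 0 => 1
  | n + 1 => qFact n * qInt (n + 1)

/-- the Gaussian binomial coefficient `[m choose j]_q`. -/
def qBinom (m j : ℕ) : KK :=
  (∏ t ∈ Finset.range j, qInt (m - t)) / (∏ t ∈ Finset.range j, qInt (j - t))

/-- the Cartan matrix of `sl`:  `cartan i j = αⱼ(h_i)`. -/
def cartan (i j : ℕ) : ℤ := if i = j then 2 else if i + 1 = j ∨ j + 1 = i then -1 else 0

/-- The quantum group with `d` nodes (`d = k - 1` for `U_q(sl_k)`): a unital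
associative `ℚ(q)`-algebra generated by elements `e i, f i, K i, Kinv i`
(`1 ≤ i ≤ d`, where `K i = q^{h_i}`) subject to the standard relations. -/
structure QGroup (d : ℕ) where
  U : Type
  [ring : Ring U]
  [alg : Algebra KK U]
  e : ℕ → U
  f : ℕ → U
  K : ℕ → U
  Kinv : ℕ → U
  K_mul_Kinv : ∀ i, 1 ≤ i → i ≤ d → K i * Kinv i = 1
  Kinv_mul_K : ∀ i, 1 ≤ i → i ≤ d → Kinv i * K i = 1
  K_comm : ∀ i j, 1 ≤ i → i ≤ d → 1 ≤ j → j ≤ d → K i * K j = K j * K i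
  K_e_Kinv : ∀ i j, 1 ≤ i → i ≤ d → 1 ≤ j → j ≤ d →
      K i * e j * Kinv i = (qv ^ cartan i j) • e j
  K_f_Kinv : ∀ i j, 1 ≤ i → i ≤ d → 1 ≤ j → j ≤ d →
      K i * f j * Kinv i = (qv ^ (-cartan i j)) • f j
  e_f_comm : ∀ i j, 1 ≤ i → i ≤ d → 1 ≤ j → j ≤ d →
      e i * f j - f j * e i = if i = j then (qv - qv⁻¹)⁻¹ • (K i - Kinv i) else 0
  serre_e : ∀ i j, 1 ≤ i → i ≤ d → 1 ≤ j → j ≤ d → (i + 1 = j ∨ j + 1 = i) →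
      e i * e i * e j - (qv + qv⁻¹) • (e i * e j * e i) + e j * e i * e i = 0
  serre_f : ∀ i j, 1 ≤ i → i ≤ d → 1 ≤ j → j ≤ d → (i + 1 = j ∨ j + 1 = i) →
      f i * f i * f j - (qv + qv⁻¹) • (f i * f j * f i) + f j * f i * f i = 0
  comm_e : ∀ i j, 1 ≤ i → i ≤ d → 1 ≤ j → j ≤ d → (i + 1 < j ∨ j + 1 < i) →
      e i * e j = e j * e i
  comm_f : ∀ i j, 1 ≤ i → i ≤ d → 1 ≤ j → j ≤ d → (i + 1 < j ∨ j + 1 < i) →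
      f i * f j = f j * f i
  gen : ∀ x : U, x ∈ Algebra.adjoin KK
      {y : U | ∃ i, 1 ≤ i ∧ i ≤ d ∧ (y = e i ∨ y = f i ∨ y = K i ∨ y = Kinv i)}

attribute [instance] QGroup.ring QGroup.alg

variable {d : ℕ} (G : QGroup d)

/-- the divided power `f_i^{(n)} = f_iⁿ/[n]_q!`. -/
def fDiv (i n : ℕ) : G.U := (qFact n)⁻¹ • (G.f i) ^ n

/-- the divided power `e_i^{(n)} = e_iⁿ/[n]_q!`. -/
def eDiv (i n : ℕ) : G.U := (qFact n)⁻¹ • (G.e i) ^ n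

variable {V : Type} [AddCommGroup V] [Module KK V] [Module G.U V] [IsScalarTower KK G.U V]

/-- `u` is a weight vector of weight `μ` (recorded via `μ i = μ(h_i)`). -/
def IsWtVec (u : V) (μ : ℕ → ℤ) : Prop :=
  ∀ i, 1 ≤ i → i ≤ d → G.K i • u = (qv ^ μ i) • u

/-- `V` is an irreducible highest weight module over `G` with highest weight
`lam` and highest weight vector `v`: it is finite dimensional over `ℚ(q)`,
has a weight space decomposition, `v` is a nonzero weight vector of weight
`lam` annihilated by the `e_i`, `V` is generated by `v`, and `V` is
irreducible. -/
structure IsHWModule (lam : ℕ → ℤ) (v : V) : Prop where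
  findim : FiniteDimensional KK V
  ne_zero : v ≠ 0
  wt : IsWtVec G v lam
  hw : ∀ i, 1 ≤ i → i ≤ d → G.e i • v = 0
  gen : ∀ w : V, ∃ p : G.U, p • v = w
  irred : ∀ W : Submodule G.U V, W = ⊥ ∨ W = ⊤
  decomp : Submodule.span KK {u : V | ∃ μ : ℕ → ℤ, IsWtVec G u μ} = ⊤

/-- the weight `m ω_a`. -/
def omWt (a m : ℕ) : ℕ → ℤ := fun i => if i = a then (m : ℤ) else 0

/-- the weight `j ω_{a-1} + (m - j) ω_a`. -/
def hookWt (a m j : ℕ) : ℕ → ℤ := fun i =>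
  (if i = a - 1 then (j : ℤ) else 0) + (if i = a then (m : ℤ) - (j : ℤ) else 0)

/-- `f_{a'}^{(c_{a'})} ⋯ f_{a+1}^{(c_{a+1})} f_a^{(c_a)} • v`. -/
def fDivChain (c : ℕ → ℕ) (a a' : ℕ) (v : V) : V :=
  (List.range (a' + 1 - a)).foldl (fun u r => fDiv G (a + r) (c (a + r)) • u) v

lemma qv_ne_zero : qv ≠ 0 := RatFunc.X_ne_zero

lemma qv_pow_ne_one {n : ℕ} (hn : n ≠ 0) : qv ^ n ≠ 1 := by
  intro h
  have h1 : (algebraMap (Polynomial ℚ) KK) (Polynomial.X ^ n) = algebraMap (Polynomial ℚ) KK 1 := by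
    rw [map_pow, RatFunc.algebraMap_X, map_one]
    exact h
  have h2 := congrArg Polynomial.natDegree (RatFunc.algebraMap_injective ℚ h1)
  simp at h2
  exact hn h2

lemma qv_zpow_ne_one {n : ℤ} (hn : n ≠ 0) : qv ^ n ≠ 1 := by
  obtain ⟨k, rfl | rfl⟩ := n.eq_nat_or_neg
  · rw [zpow_natCast]
    exact qv_pow_ne_one (by simpa using hn)
  · rw [zpow_neg, zpow_natCast, ne_eq, inv_eq_one]
    exact qv_pow_ne_one (by simpa using hn)

lemma qv_zpow_injective : Function.Injective (fun n : ℤ => qv ^ n) := by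
  intro x y h
  by_contra hne
  apply qv_zpow_ne_one (sub_ne_zero.mpr hne)
  rw [zpow_sub₀ qv_ne_zero]
  exact div_eq_one_iff_eq (zpow_ne_zero _ qv_ne_zero) |>.mpr h

/-- The quantum integer `[n]_q` for an arbitrary integer `n`. -/
def qIntZ (n : ℤ) : KK := (qv ^ n - qv ^ (-n)) / (qv - qv⁻¹)

lemma qv_sub_inv_ne_zero : qv - qv⁻¹ ≠ 0 := by
  rw [sub_ne_zero]
  intro h
  have : (fun n : ℤ => qv ^ n) 1 = (fun n : ℤ => qv ^ n) (-1) := by simpa using h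
  exact absurd (qv_zpow_injective this) (by norm_num)

lemma qIntZ_ne_zero {n : ℤ} (hn : n ≠ 0) : qIntZ n ≠ 0 := by
  refine div_ne_zero (sub_ne_zero.mpr fun h => ?_) qv_sub_inv_ne_zero
  have := qv_zpow_injective h
  omega

lemma qIntZ_zero : qIntZ 0 = 0 := by simp [qIntZ]

lemma qInt_eq_qIntZ (n : ℕ) : qInt n = qIntZ n := by simp [qInt, qIntZ]

lemma qFact_ne_zero (n : ℕ) : qFact n ≠ 0 := by
  induction n with
  | zero => exact one_ne_zero
  | succ n ih =>
    refine mul_ne_zero ih ?_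
    rw [qInt_eq_qIntZ]
    exact qIntZ_ne_zero (by positivity)

lemma qIntZ_recurrence (r p : ℤ) :
    qIntZ (r + 1) * qIntZ (p - r) = qIntZ r * qIntZ (p - r + 1) + qIntZ (p - 2 * r) := by
  have hq := qv_ne_zero
  have h1 := qv_sub_inv_ne_zero
  have e1 : p - 2 * r = p - r - r := by ring
  unfold qIntZ
  rw [e1]
  simp only [neg_sub, neg_add_rev, zpow_sub₀ hq, zpow_add₀ hq, zpow_neg, zpow_one]
  have hr : qv ^ r ≠ 0 := zpow_ne_zero _ hq
  have hp : qv ^ p ≠ 0 := zpow_ne_zero _ hq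
  generalize qv ^ r = R at *
  generalize qv ^ p = P at *
  rw [div_mul_div_comm, div_mul_div_comm, div_add_div _ _ (mul_ne_zero h1 h1) h1,
    div_eq_div_iff (mul_ne_zero h1 h1) (mul_ne_zero (mul_ne_zero h1 h1) h1)]
  field_simp
  ring

section Action

lemma K_smul_f_smul {i l : ℕ} (hi : 1 ≤ i) (hid : i ≤ d) (hl : 1 ≤ l) (hld : l ≤ d) (u : V) :
    G.K i • G.f l • u = qv ^ (-cartan i l) • G.f l • G.K i • u := by
  have h : G.K i * G.f l = (qv ^ (-cartan i l)) • (G.f l * G.K i) := by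
    rw [← smul_mul_assoc, ← G.K_f_Kinv i l hi hid hl hld, mul_assoc, G.Kinv_mul_K i hi hid, mul_one]
  rw [← mul_smul, h, smul_assoc, mul_smul]

lemma K_smul_f_pow_smul {i l : ℕ} (hi : 1 ≤ i) (hid : i ≤ d) (hl : 1 ≤ l) (hld : l ≤ d)
    {u : V} {p : ℤ} (hu : G.K i • u = qv ^ p • u) (r : ℕ) :
    G.K i • G.f l ^ r • u = qv ^ (p - r * cartan i l) • G.f l ^ r • u := by
  induction r with
  | zero => simpa using hu
  | succ r ih =>
    rw [pow_succ', mul_smul, K_smul_f_smul G hi hid hl hld, ih, smul_comm (G.f l), smul_smul,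
      ← zpow_add₀ qv_ne_zero]
    congr 2
    push_cast
    ring

lemma Kinv_smul_of_K_smul {i : ℕ} (hi : 1 ≤ i) (hid : i ≤ d) {u : V} {p : ℤ}
    (hu : G.K i • u = qv ^ p • u) : G.Kinv i • u = qv ^ (-p) • u := by
  have h : G.Kinv i • G.K i • u = u := by rw [← mul_smul, G.Kinv_mul_K i hi hid, one_smul]
  rw [hu, smul_comm] at h
  rw [zpow_neg, eq_inv_smul_iff₀ (zpow_ne_zero _ qv_ne_zero), h]

omit [Module KK V] [IsScalarTower KK G.U V] in
lemma e_smul_f_pow_smul_of_ne {i l : ℕ} (hi : 1 ≤ i) (hid : i ≤ d) (hl : 1 ≤ l) (hld : l ≤ d)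
    (hil : i ≠ l) (r : ℕ) (u : V) : G.e i • G.f l ^ r • u = G.f l ^ r • G.e i • u := by
  have h : Commute (G.e i) (G.f l) := by
    have := G.e_f_comm i l hi hid hl hld
    rw [if_neg hil] at this
    exact sub_eq_zero.mp this
  rw [← mul_smul, (h.pow_right r).eq, mul_smul]

lemma e_smul_f_smul_self {i : ℕ} (hi : 1 ≤ i) (hid : i ≤ d) {u : V} {p : ℤ}
    (hu : G.K i • u = qv ^ p • u) :
    G.e i • G.f i • u = G.f i • G.e i • u + qIntZ p • u := by
  have h := G.e_f_comm i i hi hid hi hid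
  rw [if_pos rfl, sub_eq_iff_eq_add] at h
  rw [← mul_smul, h, add_smul, smul_assoc, sub_smul, hu, Kinv_smul_of_K_smul G hi hid hu,
    mul_smul, ← sub_smul, smul_smul, add_comm, qIntZ, div_eq_inv_mul]

lemma e_smul_f_pow_succ_smul {i : ℕ} (hi : 1 ≤ i) (hid : i ≤ d) {u : V} {p : ℤ}
    (hu : G.K i • u = qv ^ p • u) (he : G.e i • u = 0) (r : ℕ) :
    G.e i • G.f i ^ (r + 1) • u = (qIntZ (r + 1) * qIntZ (p - r)) • G.f i ^ r • u := by
  have hK (r : ℕ) := K_smul_f_pow_smul G hi hid hi hid hu r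
  simp only [cartan, if_true] at hK
  induction r with
  | zero =>
    have h := e_smul_f_smul_self G hi hid (hK 0)
    have hrec := qIntZ_recurrence 0 p
    rw [qIntZ_zero] at hrec
    simp only [pow_zero, one_smul, he, smul_zero, zero_add] at h
    simp only [zero_add, pow_one, pow_zero, one_smul, Nat.cast_zero] at h hrec ⊢
    rw [hrec, h]
    simp
  | succ r ih =>
    rw [pow_succ' _ (r + 1), mul_smul, e_smul_f_smul_self G hi hid (hK (r + 1)), ih, smul_comm,
      ← mul_smul (G.f i), ← pow_succ', ← add_smul,
      qIntZ_recurrence ((r + 1 : ℕ) : ℤ) p]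
    push_cast
    rw [show p - ((r : ℤ) + 1) + 1 = p - r by ring, mul_comm (2 : ℤ)]

lemma f_pow_smul_ne_zero {i : ℕ} (hi : 1 ≤ i) (hid : i ≤ d) {u : V} {p : ℤ}
    (hu : G.K i • u = qv ^ p • u) (he : G.e i • u = 0) (hne : u ≠ 0) (r : ℕ)
    (hr : r ≤ p ∨ p < 0) :
    G.f i ^ r • u ≠ 0 := by
  induction r with
  | zero => simpa using hne
  | succ r ih =>
    intro h0
    have h := e_smul_f_pow_succ_smul G hi hid hu he r
    rw [h0, smul_zero] at h
    refine smul_ne_zero (mul_ne_zero (qIntZ_ne_zero ?_) (qIntZ_ne_zero ?_)) (ih ?_) h.symm <;>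
    push_cast at hr <;> omega

variable [FiniteDimensional KK V]

/-- In a finite-dimensional module, a nonzero singular vector has nonnegative weight. -/
lemma eq_zero_of_neg_weight {i : ℕ} (hi : 1 ≤ i) (hid : i ≤ d) {u : V} {p : ℤ}
    (hu : G.K i • u = qv ^ p • u) (he : G.e i • u = 0) (hp : p < 0) : u = 0 := by
  by_contra hne
  have hli : LinearIndependent KK (fun r : ℕ => G.f i ^ r • u) := by
    refine Module.End.eigenvectors_linearIndependent' (Module.toModuleEnd KK V (G.K i))
      (fun r : ℕ => qv ^ (p - 2 * r)) ?_ _ fun r => ?_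
    · intro x y h
      have := qv_zpow_injective h
      omega
    · refine ⟨Module.End.mem_eigenspace_iff.mpr ?_, f_pow_smul_ne_zero G hi hid hu he hne r (.inr hp)⟩
      have h := K_smul_f_pow_smul G hi hid hi hid hu r
      simp only [cartan, if_true] at h
      rw [mul_comm 2]
      exact h
  exact not_finite_iff_infinite.mpr inferInstance hli.finite

/-- A singular vector of weight `n` is killed by `f_i ^ (n + 1)`. -/
lemma f_pow_succ_smul_eq_zero {i : ℕ} (hi : 1 ≤ i) (hid : i ≤ d) {u : V} {n : ℕ}
    (hu : G.K i • u = qv ^ (n : ℤ) • u) (he : G.e i • u = 0) : G.f i ^ (n + 1) • u = 0 := by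
  have hK := K_smul_f_pow_smul G hi hid hi hid hu (n + 1)
  refine eq_zero_of_neg_weight G hi hid hK ?_ ?_
  · rw [e_smul_f_pow_succ_smul G hi hid hu he, sub_self, qIntZ_zero, mul_zero, zero_smul]
  · simp only [cartan, if_true]
    push_cast
    omega

end Action

lemma sum_range_cartan (a n i : ℕ) :
    ∑ r ∈ Finset.range n, cartan i (a + r) =
      (if a ≤ i ∧ i < a + n then 2 else 0) - (if a ≤ i + 1 ∧ i + 1 < a + n then 1 else 0) -
        (if a + 1 ≤ i ∧ i < a + n + 1 then 1 else 0) := by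
  induction n with
  | zero =>
    simp only [Finset.range_zero, Finset.sum_empty]
    split_ifs <;> omega
  | succ n ih =>
    rw [Finset.sum_range_succ, ih, cartan]
    split_ifs <;> omega

/-- The weight of `f_{a+n-1}^{(j)} ⋯ f_a^{(j)} v_λ` for `λ = m ω_a`. -/
def chainWt (a m j n : ℕ) : ℕ → ℤ := fun i =>
  omWt a m i - j * ∑ r ∈ Finset.range n, cartan i (a + r)

/-- The data carried through the successive application of `f_a^{(j)}, f_{a+1}^{(j)}, …`. -/
structure IsChainVec (a m j n : ℕ) (u : V) : Prop where
  ne_zero : u ≠ 0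
  wt : IsWtVec G u (chainWt a m j n)
  e_smul : ∀ i, 1 ≤ i → i ≤ d → (n = 0 ∨ i + 1 ≠ a + n) → G.e i • u = 0
  f_pow_e_smul : 1 ≤ n → a + n ≤ d → G.f (a + n) ^ j • G.e (a + n - 1) • u = 0

section Chain

variable {G}

lemma IsChainVec.step [FiniteDimensional KK V] {a m j n : ℕ} (ha : 1 ≤ a) (hj : j ≤ m)
    (hn : a + n ≤ d) {u : V} (h : IsChainVec G a m j n u) :
    IsChainVec G a m j (n + 1) (fDiv G (a + n) j • u) := by
  have hs : (qFact j)⁻¹ ≠ 0 := inv_ne_zero (qFact_ne_zero j)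
  have h1 : 1 ≤ a + n := by omega
  have he : G.e (a + n) • u = 0 := h.e_smul _ h1 hn (by omega)
  have hw : (j : ℤ) ≤ chainWt a m j n (a + n) := by
    rw [chainWt, sum_range_cartan, omWt]
    rcases Nat.eq_zero_or_pos n with rfl | hpos
    · simpa using hj
    · rw [if_neg (by omega), if_neg (by omega), if_neg (by omega), if_pos (by omega)]
      simp
  rw [fDiv, smul_assoc]
  refine ⟨smul_ne_zero hs (f_pow_smul_ne_zero G h1 hn (h.wt _ h1 hn) he h.ne_zero j (.inl hw)),
    ?_, ?_, ?_⟩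
  · intro i hi hid
    rw [smul_comm, K_smul_f_pow_smul G hi hid h1 hn (h.wt i hi hid), smul_comm (qFact j)⁻¹]
    congr 2
    rw [chainWt, chainWt, Finset.sum_range_succ]
    ring
  · intro i hi hid hin
    rw [smul_comm, e_smul_f_pow_smul_of_ne G hi hid h1 hn (by omega)]
    by_cases hc : n = 0 ∨ i + 1 ≠ a + n
    · rw [h.e_smul i hi hid hc, smul_zero, smul_zero]
    · push Not at hc
      obtain rfl : i = a + n - 1 := by omega
      rw [h.f_pow_e_smul (by omega) hn, smul_zero]
  · intro _ hn'
    rw [show a + (n + 1) - 1 = a + n by omega, smul_comm (G.e _), smul_comm (G.f _ ^ j)]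
    cases j with
    | zero => simp [he]
    | succ r =>
      rw [e_smul_f_pow_succ_smul G h1 hn (h.wt _ h1 hn) he, smul_comm (G.f _ ^ (r + 1))]
      have hK := K_smul_f_pow_smul G (by omega) hn' h1 hn (h.wt _ (by omega) hn') r
      have hwt : chainWt a m (r + 1) n (a + (n + 1)) - r * cartan (a + (n + 1)) (a + n) = r := by
        rw [chainWt, sum_range_cartan, omWt, cartan]
        rw [if_neg (by omega), if_neg (by omega), if_neg (by omega), if_neg (by omega),
          if_neg (by omega), if_pos (by omega)]
        simp
      rw [hwt] at hK
      have he' : G.e (a + (n + 1)) • G.f (a + n) ^ r • u = 0 := by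
        rw [e_smul_f_pow_smul_of_ne G (by omega) hn' h1 hn (by omega),
          h.e_smul _ (by omega) hn' (by omega), smul_zero]
      rw [f_pow_succ_smul_eq_zero G (by omega) hn' hK he', smul_zero, smul_zero]

lemma IsHWModule.isChainVec {a m j : ℕ} (ha : 1 ≤ a) (hj : j ≤ m) {v : V}
    (hV : IsHWModule G (omWt a m) v) (n : ℕ) (hn : a + n ≤ d + 1) :
    IsChainVec G a m j n
      ((List.range n).foldl (fun u r => fDiv G (a + r) j • u) v) := by
  have := hV.findim
  induction n with
  | zero =>
    refine ⟨hV.ne_zero, ?_, fun i hi hid _ => hV.hw i hi hid, fun h => absurd h (by omega)⟩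
    intro i hi hid
    simpa [chainWt] using hV.wt i hi hid
  | succ n ih =>
    rw [List.range_succ, List.foldl_append]
    exact (ih (by omega)).step ha hj (by omega)

end Chain

/-- Proposition `vanish`:  for `λ = m ω_a` and `0 ≤ j ≤ m`
set `v_j = f_{k-1}^{(j)} ⋯ f_a^{(j)} v_λ`.  Then `v_j ≠ 0`, `e_i v_j = 0` for
`1 ≤ i ≤ k - 2`, `f_i v_j = 0` for `i ∈ {1, …, k-2} \ {a-1, a}`, and
`f_{a-1}^{j+1} v_j = 0` (when `a ≥ 2`) and `f_a^{m-j+1} v_j = 0`. -/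
theorem highest_weight_properties_of_vj
    (k a m j : ℕ) (hk : 2 ≤ k) (ha : 1 ≤ a) (hak : a ≤ k - 1) (hm : 1 ≤ m)
    (hj : j ≤ m)
    (G : QGroup (k - 1)) (V : Type) [AddCommGroup V] [Module KK V] [Module G.U V]
    [IsScalarTower KK G.U V]
    (v : V) (hV : IsHWModule G (omWt a m) v)
    (vj : V) (hvj : vj = fDivChain G (fun _ => j) a (k - 1) v) :
    vj ≠ 0 ∧
    (∀ i, 1 ≤ i → i ≤ k - 2 → G.e i • vj = 0) ∧
    (∀ i, 1 ≤ i → i ≤ k - 2 → i ≠ a - 1 → i ≠ a → G.f i • vj = 0) ∧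
    (2 ≤ a → (G.f (a - 1)) ^ (j + 1) • vj = 0) ∧
    (G.f a) ^ (m - j + 1) • vj = 0 := by
  have := hV.findim
  obtain ⟨hne, hwt, he, -⟩ := hV.isChainVec (j := j) ha hj (k - 1 + 1 - a) (by omega)
  have hvj' : (List.range (k - 1 + 1 - a)).foldl (fun u r => fDiv G (a + r) j • u) v = vj :=
    hvj.symm
  rw [hvj'] at hne hwt he
  replace he : ∀ i, 1 ≤ i → i ≤ k - 2 → G.e i • vj = 0 := fun i hi hik =>
    he i hi (by omega) (by omega)
  have hf (i n : ℕ) (hi : 1 ≤ i) (hik : i ≤ k - 2)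
      (hn : chainWt a m j (k - 1 + 1 - a) i = n) : G.f i ^ (n + 1) • vj = 0 := by
    have hK := hwt i hi (by omega)
    rw [hn] at hK
    exact f_pow_succ_smul_eq_zero G hi (by omega) hK (he i hi hik)
  refine ⟨hne, he, fun i hi hik hia hia' => ?_, fun ha2 => ?_, ?_⟩
  · have h := hf i 0 hi hik ?_
    · simpa using h
    · rw [chainWt, sum_range_cartan, omWt, if_neg hia']
      split_ifs <;> omega
  · refine hf (a - 1) j (by omega) (by omega) ?_
    rw [chainWt, sum_range_cartan, omWt, if_neg (by omega), if_neg (by omega),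
      if_pos (by omega), if_neg (by omega)]
    simp
  · by_cases hlast : a = k - 1
    · have hv1 : vj = fDiv G a j • v := by
        rw [hvj, fDivChain, show k - 1 + 1 - a = 1 by omega]
        simp [List.range_succ]
      rw [hv1, fDiv, smul_assoc, smul_comm, ← mul_smul, ← pow_add,
        show m - j + 1 + j = m + 1 by omega]
      have hK := hV.wt a ha hak
      rw [omWt, if_pos rfl] at hK
      rw [f_pow_succ_smul_eq_zero G ha hak hK (hV.hw a ha hak), smul_zero]
    · refine hf a (m - j) ha (by omega) ?_
      rw [chainWt, sum_range_cartan, omWt, if_pos rfl, if_pos (by omega),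
        if_pos (by omega), if_neg (by omega)]
      push_cast [hj]
      ring

end QSL
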